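/- Let S be the multiplicative subset of ℚ[T,T⁻¹] consisting of Laurent polynomials p with eval₁(p) ≠ 0. Then ι maps every element of S to a unit of ℚ⟦X⟧, so ι induces a ℚ-algebra homomorphism from the localization of ℚ[T,T⁻¹] at S into ℚ⟦X⟧, and this induced homomorphism is injective. -/

import Mathlib

open LaurentPolynomial PowerSeries

/-- An algebra homomorphism out of Laurent polynomials is determined by its value at `T`. -/
theorem LaurentPolynomial.algHom_ext_T {R A : Type*} [CommSemiring R] [CommSemiring A]
    [Algebra R A] {f g : LaurentPolynomial R →ₐ[R] A}
    (h : f (LaurentPolynomial.T 1) = g (LaurentPolynomial.T 1)) : f = g := by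
  have hpoly : f.comp Polynomial.toLaurentAlg = g.comp Polynomial.toLaurentAlg :=
    Polynomial.algHom_ext (by simpa using h)
  apply AlgHom.coe_ringHom_injective
  exact IsLocalization.ringHom_ext (Submonoid.powers (Polynomial.X : Polynomial R))
    (congrArg AlgHom.toRingHom hpoly)

/-- A non-constant power series over a field is transcendental: factor out of a polynomial
relation the largest power of `X - a`, where `a` is the constant coefficient. -/
theorem PowerSeries.transcendental_of_ne_C_constantCoeff {K : Type*} [Field K]
    {φ : PowerSeries K} (hφ : φ ≠ PowerSeries.C (PowerSeries.constantCoeff φ)) :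
    Transcendental K φ := by
  rw [transcendental_iff]
  intro p hp
  by_contra hp0
  obtain ⟨q, hpq, hq⟩ :=
    Polynomial.exists_eq_pow_rootMultiplicity_mul_and_not_dvd p hp0 (PowerSeries.constantCoeff φ)
  rw [hpq, map_mul, map_pow, map_sub, Polynomial.aeval_X, Polynomial.aeval_C] at hp
  rcases mul_eq_zero.mp hp with h | h
  · exact hφ (sub_eq_zero.mp (eq_zero_of_pow_eq_zero h))
  · apply hq
    rw [Polynomial.dvd_iff_isRoot, Polynomial.IsRoot.def]
    have hc := congrArg (PowerSeries.constantCoeff (R := K)) h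
    rwa [map_zero, Polynomial.aeval_def, Polynomial.hom_eval₂,
      PowerSeries.algebraMap_eq, PowerSeries.constantCoeff_comp_C, Polynomial.eval₂_id] at hc

theorem PowerSeries.transcendental_exp : Transcendental ℚ (PowerSeries.exp ℚ) := by
  apply PowerSeries.transcendental_of_ne_C_constantCoeff
  intro h
  simpa [PowerSeries.coeff_exp, PowerSeries.coeff_C] using congrArg (PowerSeries.coeff 1) h

/-- An algebra homomorphism sending `T` to a transcendental element is injective. -/
theorem LaurentPolynomial.algHom_injective_of_transcendental {R A : Type*} [CommRing R]
    [CommRing A] [Algebra R A] (f : LaurentPolynomial R →ₐ[R] A)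
    (h : Transcendental R (f (LaurentPolynomial.T 1))) : Function.Injective f := by
  rw [injective_iff_map_eq_zero]
  intro p hp
  obtain ⟨n, q, hq⟩ := LaurentPolynomial.exists_T_pow p
  have hcomp : f.comp Polynomial.toLaurentAlg =
      Polynomial.aeval (f (LaurentPolynomial.T 1)) :=
    Polynomial.algHom_ext (by simp)
  have hq0 : q = 0 := by
    refine transcendental_iff.mp h q ?_
    rw [← hcomp, AlgHom.comp_apply, Polynomial.toLaurentAlg_apply, hq, map_mul, hp, zero_mul]
  rw [hq0, map_zero] at hq
  exact (LaurentPolynomial.isUnit_T (n : ℤ)).mul_left_eq_zero.mp hq.symm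

/-- Let `S` be the multiplicative subset of `ℚ[T,T⁻¹]` of Laurent polynomials
nonvanishing at `t = 1`.  The substitution `ι : t ↦ e^k` maps every element of
`S` to a unit of `ℚ⟦X⟧`, hence induces a homomorphism from the localization of
`ℚ[T,T⁻¹]` at `S` (the ring `ℚ¹(t)`) into `ℚ⟦X⟧`, and this induced
homomorphism is injective. -/
theorem subst_exp_localization_injective
    (ι : LaurentPolynomial ℚ →ₐ[ℚ] PowerSeries ℚ)
    (hι : ι (LaurentPolynomial.T 1) = PowerSeries.exp ℚ)
    (eval₁ : LaurentPolynomial ℚ →ₐ[ℚ] ℚ)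
    (heval : eval₁ (LaurentPolynomial.T 1) = 1)
    (S : Submonoid (LaurentPolynomial ℚ))
    (hS : ∀ p : LaurentPolynomial ℚ, p ∈ S ↔ eval₁ p ≠ 0) :
    ∃ hu : ∀ y : S, IsUnit (ι.toRingHom y),
      Function.Injective (IsLocalization.lift (S := Localization S) hu) := by
  have hconst (p : LaurentPolynomial ℚ) : PowerSeries.constantCoeff (ι p) = eval₁ p := by
    let c : PowerSeries ℚ →ₐ[ℚ] ℚ :=
      { PowerSeries.constantCoeff with
        commutes' := fun r => by simp }
    have hc : c.comp ι = eval₁ := LaurentPolynomial.algHom_ext_T <| by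
      change PowerSeries.constantCoeff (ι (LaurentPolynomial.T 1)) = _
      rw [hι, heval, PowerSeries.constantCoeff_exp]
    exact DFunLike.congr_fun hc p
  have hu (y : S) : IsUnit (ι.toRingHom y) := by
    rw [PowerSeries.isUnit_iff_constantCoeff, isUnit_iff_ne_zero]
    exact (hconst y).trans_ne ((hS y).mp y.2)
  have hinj : Function.Injective ι :=
    LaurentPolynomial.algHom_injective_of_transcendental ι
      (hι ▸ PowerSeries.transcendental_exp)
  refine ⟨hu, (IsLocalization.lift_injective_iff hu).mpr fun x y => ⟨fun h => ?_, fun h => ?_⟩⟩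
  · simpa only [IsLocalization.lift_eq] using congrArg (IsLocalization.lift hu) h
  · exact congrArg _ (hinj h)
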